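/- arXiv:2312.14282 — 2 statements merged into one kernel-verified Lean document; each statement's English description precedes it below -/
import Mathlib

section
/- Let M be a module in category O^∞ and for i ∈ Z_{≥1} set M^i := ⊕_{λ∈Π(M)} M^i_λ. Then (a) each M^i is a U(g_E)-submodule of M belonging to O^∞; (b) M^1 is a submodule lying in category O, and M^1 is non-zero whenever M is non-zero; (c) there exists i ∈ Z_{>0} such that M = M^i. -/
noncomputable section

namespace PaperO

variable (E : Type) [Field E]
variable (g : Type) [LieRing g] [LieAlgebra E g]
variable (t b : LieSubalgebra E g)

section WeightTheory

variable (M : Type) [AddCommGroup M] [Module E M] [LieRingModule g M] [LieModule E g M]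

/-- `M^i_χ`: the subspace of all `m` with `(h - χ(h))^i • m = 0` for all `h ∈ t`. -/
def wsp (i : ℕ) (χ : Module.Dual E ↥t) : Submodule E M :=
  ⨅ h : ↥t, LinearMap.ker ((LieModule.toEnd E g M (h : g) - χ h • (1 : Module.End E M)) ^ i)

/-- The generalized weight space `M^∞_χ = ⋃ i, M^i_χ`. -/
def gwsp (χ : Module.Dual E ↥t) : Submodule E M := ⨆ i : ℕ, wsp E g t M i χ

/-- The set of weights `Π(M)` of `M`. -/
def weights : Set (Module.Dual E ↥t) := {χ | gwsp E g t M χ ≠ ⊥}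

/-- `M` is `E`-split: it is the direct sum of its generalized weight spaces. -/
def IsESplit : Prop :=
  letI : DecidableEq (Module.Dual E ↥t) := Classical.decEq _
  DirectSum.IsInternal (fun χ : Module.Dual E ↥t => gwsp E g t M χ)

/-- `M` is diagonalizable: it is the direct sum of its weight spaces. -/
def IsDiagonalizable : Prop :=
  letI : DecidableEq (Module.Dual E ↥t) := Classical.decEq _
  DirectSum.IsInternal (fun χ : Module.Dual E ↥t => wsp E g t M 1 χ)

/-- The action of `b` on `M` is locally finite: every `m ∈ M` lies in a
finite-dimensional `b`-stable subspace (equivalently, `U(b)·m` is finite-dimensional). -/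
def IsLocBFinite : Prop :=
  ∀ m : M, ∃ W : Submodule E M, FiniteDimensional E ↥W ∧ m ∈ W ∧
    ∀ x : ↥b, ∀ w ∈ W, ⁅(x : g), w⁆ ∈ W

/-- `M` is finitely generated as a `U(g)`-module (equivalently, as a Lie module). -/
def IsFG : Prop := ∃ S : Finset M, LieSubmodule.lieSpan E g (S : Set M) = ⊤

/-- Membership in the BGG category `O` for `(g, b, t)`. -/
def InCatO : Prop := IsFG E g M ∧ IsDiagonalizable E g t M ∧ IsLocBFinite E g b M

/-- Membership in the thick category `O^∞` for `(g, b, t)`. -/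
def InCatOInf : Prop := IsFG E g M ∧ IsESplit E g t M ∧ IsLocBFinite E g b M

variable (Λ : AddSubgroup (Module.Dual E ↥t))

/-- All weights of `M` are algebraic, i.e. lie in the subgroup `Λ ⊆ t*` which is
the image of the derivative map `d : X*(T) → t*`. -/
def IsAlgWt : Prop := ∀ χ ∈ weights E g t M, χ ∈ Λ

/-- Membership in the category `O_alg`. -/
def InCatOAlg : Prop := InCatO E g t b M ∧ IsAlgWt E g t M Λ

/-- Membership in the category `O^∞_alg`. -/
def InCatOInfAlg : Prop := InCatOInf E g t b M ∧ IsAlgWt E g t M Λ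

end WeightTheory

/-- The root space `g_α` for a linear form `α` on `t`. -/
def rootSp (α : Module.Dual E ↥t) : Submodule E g :=
  ⨅ h : ↥t, LinearMap.ker (((LieAlgebra.ad E g) (h : g) - α h • (1 : Module.End E g)))

/-- Commuting operators indexed linearly by a finite-dimensional space generate a Noetherian
commutative algebra, so a module finitely generated under them has the ascending chain condition
on stable subspaces. -/
theorem wellFoundedGT_stable_of_commute {V : Type} [AddCommGroup V] [Module E V]
    [Module.Finite E g] (T : g →ₗ[E] Module.End E V) (hcomm : ∀ x y, Commute (T x) (T y))
    (F : Set V) (hF : F.Finite)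
    (hgen : ∀ p : Submodule E V, F ⊆ p → (∀ x, ∀ v ∈ p, T x v ∈ p) → p = ⊤) :
    WellFoundedGT {p : Submodule E V // ∀ x, ∀ v ∈ p, T x v ∈ p} := by
  obtain ⟨B, hB⟩ := Module.Finite.fg_top (R := E) (M := g)
  let s : Set (Module.End E V) := T '' B
  let A := Algebra.adjoin E s
  have hs : s.Finite := B.finite_toSet.image _
  have hTA (x : g) : T x ∈ A := by
    have hx : x ∈ Submodule.span E (B : Set g) := hB ▸ Submodule.mem_top
    induction hx using Submodule.span_induction with
    | mem x hx => exact Algebra.subset_adjoin ⟨x, hx, rfl⟩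
    | zero => simp
    | add x y _ _ hx hy => simpa using add_mem hx hy
    | smul c x _ hx => simpa using A.smul_mem hx c
  have hA : IsNoetherianRing A := by
    have : IsMulCommutative A := Algebra.isMulCommutative_adjoin E (by
      rintro _ ⟨x, -, rfl⟩ _ ⟨y, -, rfl⟩
      exact hcomm x y)
    let : CommRing A :=
      { (inferInstance : Ring A) with mul_comm := mul_comm' }
    have : Algebra.FiniteType E A :=
      (Subalgebra.fg_iff_finiteType A).1 ⟨hs.toFinset, by simp [A]⟩
    exact Algebra.FiniteType.isNoetherianRing E A
  have hspan : Submodule.span A F = ⊤ := by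
    have h := hgen ((Submodule.span A F).restrictScalars E)
      (fun v hv => Submodule.subset_span hv)
      (fun x v hv => (Submodule.span A F).smul_mem (⟨T x, hTA x⟩ : A) hv)
    exact (Submodule.restrictScalars_eq_top_iff E A V).1 h
  have : Module.Finite A V := ⟨⟨hF.toFinset, by simpa using hspan⟩⟩
  have hN : IsNoetherian A V := isNoetherian_of_isNoetherianRing_of_finite A V
  have : WellFoundedGT (Submodule A V) := inferInstance
  have hst (p : Submodule E V) (hp : ∀ x, ∀ v ∈ p, T x v ∈ p) (a : Module.End E V)
      (ha : a ∈ A) : ∀ v ∈ p, a v ∈ p := by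
    induction ha using Algebra.adjoin_induction with
    | mem a ha =>
      obtain ⟨x, -, rfl⟩ := ha
      exact hp x
    | algebraMap r =>
      intro v hv
      simpa [Module.algebraMap_end_apply] using p.smul_mem r hv
    | add a b _ _ ha hb => exact fun v hv => p.add_mem (ha v hv) (hb v hv)
    | mul a b _ _ ha hb => exact fun v hv => ha _ (hb v hv)
  let L : {p : Submodule E V // ∀ x, ∀ v ∈ p, T x v ∈ p} → Submodule A V := fun p =>
    { p.1.toAddSubmonoid with
      smul_mem' := fun a v hv => hst p.1 p.2 a.1 a.2 v hv }
  have hL : StrictMono L := by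
    intro p q hpq
    refine lt_of_le_not_ge (fun v hv => hpq.le hv) (fun h => hpq.not_ge fun v hv => h hv)
  exact hL.wellFoundedGT

section Noetherian

variable (M : Type) [AddCommGroup M] [Module E M] [LieRingModule g M] [LieModule E g M]

/-- The span of the elements `x₁ ⋯ xₖ s` with `s ∈ S`, `xⱼ ∈ g` and `k < n`. -/
def wordFil (S : Set M) : ℕ → Submodule E M
  | 0 => ⊥
  | n + 1 => Submodule.span E S ⊔ wordFil S n ⊔
      ⨆ x : g, (wordFil S n).map (LieModule.toEnd E g M x)

variable {M} in
theorem wordFil_le_succ (S : Set M) (n : ℕ) : wordFil E g M S n ≤ wordFil E g M S (n + 1) :=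
  le_sup_right.trans (le_sup_left (a := Submodule.span E S ⊔ wordFil E g M S n))

variable {M} in
theorem lie_mem_wordFil (S : Set M) (n : ℕ) (x : g) {m : M} (hm : m ∈ wordFil E g M S n) :
    ⁅x, m⁆ ∈ wordFil E g M S (n + 1) :=
  Submodule.mem_sup_right (Submodule.mem_iSup_of_mem x ⟨m, hm, rfl⟩)

variable {M} in
theorem span_le_wordFil (S : Set M) (n : ℕ) :
    Submodule.span E S ≤ wordFil E g M S (n + 1) :=
  le_sup_left.trans (le_sup_left (a := Submodule.span E S ⊔ wordFil E g M S n))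

variable {M} in
theorem exists_mem_wordFil (S : Set M) (hS : LieSubmodule.lieSpan E g S = ⊤) (m : M) :
    ∃ n, m ∈ wordFil E g M S n := by
  have hdir : Directed (· ≤ ·) (wordFil E g M S) :=
    (monotone_nat_of_le_succ (wordFil_le_succ E g S)).directed_le
  let N : LieSubmodule E g M :=
    { (⨆ n, wordFil E g M S n : Submodule E M) with
      lie_mem := by
        intro x m hm
        obtain ⟨n, hn⟩ := (Submodule.mem_iSup_of_directed _ hdir).1 hm
        exact Submodule.mem_iSup_of_mem (n + 1) (lie_mem_wordFil E g S n x hn) }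
  have hN : LieSubmodule.lieSpan E g S ≤ N := by
    rw [LieSubmodule.lieSpan_le]
    exact fun s hs => Submodule.mem_iSup_of_mem 1
      (span_le_wordFil E g S 0 (Submodule.subset_span hs))
  exact (Submodule.mem_iSup_of_directed _ hdir).1 (hN (hS ▸ LieSubmodule.mem_top m))

/-- The Rees module of the filtration `wordFil`. -/
def rees (S : Set M) : Submodule E (ℕ →₀ M) :=
  ⨅ n, (wordFil E g M S (n + 1)).comap (Finsupp.lapply n)

variable {M} in
theorem mem_rees {S : Set M} {f : ℕ →₀ M} :
    f ∈ rees E g M S ↔ ∀ n, f n ∈ wordFil E g M S (n + 1) := by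
  simp [rees]

/-- The elements of the Rees module whose symbols lie in `N`. -/
def symbols (S : Set M) (N : Submodule E M) : Submodule E (rees E g M S) :=
  ⨅ n, (N ⊔ wordFil E g M S n).comap ((Finsupp.lapply n).comp (rees E g M S).subtype)

variable {M} in
theorem mem_symbols {S : Set M} {N : Submodule E M} {f : rees E g M S} :
    f ∈ symbols E g M S N ↔ ∀ n, f.1 n ∈ N ⊔ wordFil E g M S n := by
  simp [symbols]

/-- The degree one operator on finitely supported sequences given by an element of `g`. -/
def shiftLie : g →ₗ[E] Module.End E (ℕ →₀ M) where
  toFun x := Finsupp.lmapDomain M E Nat.succ ∘ₗ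
    Finsupp.mapRange.linearMap (LieModule.toEnd E g M x)
  map_add' x y := by ext n m : 2; simp [Finsupp.mapDomain_single, Finsupp.mapDomain_add]
  map_smul' c x := by ext n m : 2; simp [Finsupp.mapDomain_single]

variable {M} in
theorem shiftLie_zero (x : g) (f : ℕ →₀ M) : shiftLie E g M x f 0 = 0 := by
  refine Finsupp.mapDomain_of_notMem_range _ _ ?_
  simp

variable {M} in
theorem shiftLie_succ (x : g) (f : ℕ →₀ M) (n : ℕ) :
    shiftLie E g M x f (n + 1) = ⁅x, f n⁆ := by
  exact Finsupp.mapDomain_apply Nat.succ_injective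
    (Finsupp.mapRange.linearMap (LieModule.toEnd E g M x) f) n

variable {M} in
theorem shiftLie_single (x : g) (n : ℕ) (m : M) :
    shiftLie E g M x (Finsupp.single n m) = Finsupp.single (n + 1) ⁅x, m⁆ := by
  simp [shiftLie, Finsupp.mapDomain_single]

variable {M} in
theorem shiftLie_mem_rees (S : Set M) (x : g) :
    ∀ f ∈ rees E g M S, shiftLie E g M x f ∈ rees E g M S := by
  intro f hf
  rw [mem_rees] at hf ⊢
  rintro (_ | n)
  · simp [shiftLie_zero]
  · rw [shiftLie_succ]
    exact lie_mem_wordFil E g S _ x (hf n)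

/-- The operator `shiftLie` restricted to the Rees module. -/
def reesLie (S : Set M) : g →ₗ[E] Module.End E (rees E g M S) where
  toFun x := (shiftLie E g M x).restrict (shiftLie_mem_rees E g S x)
  map_add' x y := by ext1 f; apply Subtype.ext; simp [LinearMap.restrict_apply]
  map_smul' c x := by ext1 f; apply Subtype.ext; simp [LinearMap.restrict_apply]

variable {M} in
theorem reesLie_mem_symbols (S : Set M) (N : LieSubmodule E g M) (x : g) :
    symbols E g M S N ≤ (symbols E g M S N).comap (reesLie E g M S x) := by
  intro f hf
  rw [Submodule.mem_comap, mem_symbols]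
  rw [mem_symbols] at hf
  rintro (_ | n)
  · simp [reesLie, shiftLie_zero]
  · obtain ⟨a, ha, b, hb, hab⟩ := Submodule.mem_sup.1 (hf n)
    have h : (reesLie E g M S x f).1 (n + 1) = ⁅x, a⁆ + ⁅x, b⁆ := by
      rw [← lie_add, hab]
      exact shiftLie_succ E g x f.1 n
    rw [h]
    exact Submodule.add_mem_sup (N.lie_mem ha) (lie_mem_wordFil E g S n x hb)

theorem reesLie_mem_symbols_bot (S : Set M) (x : g) :
    symbols E g M S ⊥ ≤ (symbols E g M S ⊥).comap (reesLie E g M S x) := by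
  simpa using reesLie_mem_symbols E g S (⊥ : LieSubmodule E g M) x

/-- The action of `g` on the associated graded module of `wordFil`. -/
def grLie (S : Set M) :
    g →ₗ[E] Module.End E (rees E g M S ⧸ symbols E g M S ⊥) where
  toFun x := (symbols E g M S ⊥).mapQ _ (reesLie E g M S x) (reesLie_mem_symbols_bot E g M S x)
  map_add' x y := by ext f; simp
  map_smul' c x := by ext f; simp

variable {M}

theorem grLie_mk (S : Set M) (x : g) (f : rees E g M S) :
    grLie E g M S x ((symbols E g M S ⊥).mkQ f) =
      (symbols E g M S ⊥).mkQ (reesLie E g M S x f) := rfl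

theorem commute_grLie (S : Set M) (x y : g) :
    Commute (grLie E g M S x) (grLie E g M S y) := by
  refine LinearMap.ext fun q => ?_
  obtain ⟨f, rfl⟩ := Submodule.mkQ_surjective _ q
  simp only [Module.End.mul_apply, grLie_mk]
  rw [← sub_eq_zero, ← map_sub, Submodule.mkQ_apply, Submodule.Quotient.mk_eq_zero, mem_symbols]
  rintro (_ | _ | n)
  · simp [reesLie, shiftLie_zero]
  · simp [reesLie, shiftLie_zero, shiftLie_succ]
  · have h : (reesLie E g M S x (reesLie E g M S y f) -
        reesLie E g M S y (reesLie E g M S x f)).1 (n + 1 + 1) = ⁅⁅x, y⁆, f.1 n⁆ := by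
      simp [reesLie, shiftLie_succ]
    rw [h]
    exact Submodule.mem_sup_right
      (lie_mem_wordFil E g S (n + 1) _ ((mem_rees E g).1 f.2 n))

theorem single_mem_rees {S : Set M} {n : ℕ} {m : M} (hm : m ∈ wordFil E g M S (n + 1)) :
    Finsupp.single n m ∈ rees E g M S := by
  rw [mem_rees]
  intro k
  by_cases h : n = k
  · subst h; simpa using hm
  · simp [h]

theorem single_mem_symbols {S : Set M} {N : Submodule E M} {n : ℕ} {m : M}
    (hm : m ∈ wordFil E g M S (n + 1)) (hN : m ∈ N ⊔ wordFil E g M S n) :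
    (⟨Finsupp.single n m, single_mem_rees E g hm⟩ : rees E g M S) ∈ symbols E g M S N := by
  rw [mem_symbols]
  intro k
  by_cases h : n = k
  · subst h; simpa using hN
  · simp [h]

theorem eq_top_of_grLie_stable (S : Set M)
    (p : Submodule E (rees E g M S ⧸ symbols E g M S ⊥))
    (hp : ∀ x, ∀ v ∈ p, grLie E g M S x v ∈ p)
    (hS : ∀ s (hs : s ∈ S), (symbols E g M S ⊥).mkQ
      ⟨Finsupp.single 0 s, single_mem_rees E g
        (span_le_wordFil E g S 0 (Submodule.subset_span hs))⟩ ∈ p) : p = ⊤ := by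
  let P : Submodule E (ℕ →₀ M) := (p.comap (symbols E g M S ⊥).mkQ).map (rees E g M S).subtype
  have hP {f : ℕ →₀ M} : f ∈ P ↔ ∃ hf : f ∈ rees E g M S, (symbols E g M S ⊥).mkQ ⟨f, hf⟩ ∈ p := by
    simp [P]
  have hlow {n : ℕ} {m : M} (hm : m ∈ wordFil E g M S n) : Finsupp.single n m ∈ P := by
    refine hP.2 ⟨single_mem_rees E g (wordFil_le_succ E g S n hm), ?_⟩
    have h := single_mem_symbols E g (N := ⊥) (wordFil_le_succ E g S n hm)
      (Submodule.mem_sup_right hm)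
    rw [Submodule.mkQ_apply, (Submodule.Quotient.mk_eq_zero _).2 h]
    exact p.zero_mem
  have hspan : Submodule.span E S ≤ P.comap (Finsupp.lsingle 0) :=
    Submodule.span_le.2 fun s hs => hP.2 ⟨_, hS s hs⟩
  have key (n : ℕ) : wordFil E g M S (n + 1) ≤ P.comap (Finsupp.lsingle n) := by
    induction n with
    | zero =>
      refine sup_le (sup_le hspan bot_le) (iSup_le fun x => ?_)
      rintro _ ⟨m, hm, rfl⟩
      have : m = 0 := by simpa [wordFil] using hm
      simp [this]
    | succ n ih =>
      refine sup_le (sup_le ?_ fun m hm => hlow hm) (iSup_le fun x => ?_)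
      · exact fun m hm => hlow (span_le_wordFil E g S n hm)
      · rintro _ ⟨m, hm, rfl⟩
        obtain ⟨hf, hfp⟩ := hP.1 (ih hm)
        have := hp x _ hfp
        rw [grLie_mk] at this
        refine hP.2 ⟨?_, ?_⟩
        · exact single_mem_rees E g (lie_mem_wordFil E g S _ x hm)
        · convert this using 2
          exact Subtype.ext (shiftLie_single E g x n m).symm
  rw [eq_top_iff]
  rintro q -
  obtain ⟨f, rfl⟩ := Submodule.mkQ_surjective _ q
  have hf : f.1 ∈ P := by
    rw [← Finsupp.sum_single f.1]
    exact Submodule.sum_mem _ fun n _ => key n ((mem_rees E g).1 f.2 n)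
  exact (hP.1 hf).2

theorem comap_map_symbols (S : Set M) (N : Submodule E M) :
    ((symbols E g M S N).map (symbols E g M S ⊥).mkQ).comap (symbols E g M S ⊥).mkQ =
      symbols E g M S N := by
  rw [Submodule.comap_map_mkQ, sup_eq_right]
  intro f hf
  rw [mem_symbols] at hf ⊢
  exact fun n => sup_le_sup_right (bot_le (a := N)) _ (hf n)

theorem symbols_mono (S : Set M) {N N' : Submodule E M} (h : N ≤ N') :
    symbols E g M S N ≤ symbols E g M S N' := by
  intro f hf
  rw [mem_symbols] at hf ⊢
  exact fun n => sup_le_sup_right h _ (hf n)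

theorem le_of_symbols_le (S : Set M) (hS : LieSubmodule.lieSpan E g S = ⊤)
    {N N' : Submodule E M} (h : N ≤ N') (hs : symbols E g M S N' ≤ symbols E g M S N) :
    N' ≤ N := by
  have key (n : ℕ) : ∀ m ∈ N', m ∈ wordFil E g M S n → m ∈ N := by
    induction n with
    | zero =>
      intro m _ hm
      have : m = 0 := by simpa [wordFil] using hm
      simp [this]
    | succ n ih =>
      intro m hm hmf
      have h1 := (mem_symbols E g).1
        (hs (single_mem_symbols E g hmf (Submodule.mem_sup_left hm))) n
      simp only [Finsupp.single_eq_same] at h1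
      obtain ⟨a, ha, b, hb, rfl⟩ := Submodule.mem_sup.1 h1
      exact N.add_mem ha (ih b ((N'.add_mem_iff_right (h ha)).1 hm) hb)
  intro m hm
  obtain ⟨n, hn⟩ := exists_mem_wordFil E g S hS m
  exact key n m hm hn

/-- Finitely generated modules over a finite-dimensional Lie algebra are Noetherian. -/
theorem IsFG.wellFoundedGT [Module.Finite E g] (hM : IsFG E g M) :
    WellFoundedGT (LieSubmodule E g M) := by
  obtain ⟨S₀, hS⟩ := hM
  set S : Set M := (S₀ : Set M) with hS₀
  let F : Set (rees E g M S ⧸ symbols E g M S ⊥) := Set.range fun s : S₀ =>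
    (symbols E g M S ⊥).mkQ ⟨Finsupp.single 0 s.1, single_mem_rees E g
      (span_le_wordFil E g S 0 (Submodule.subset_span s.2))⟩
  have := wellFoundedGT_stable_of_commute E g (grLie E g M S) (commute_grLie E g S) F
    (Set.finite_range _) (fun p hF hp => eq_top_of_grLie_stable E g S p hp
      fun s hs => hF ⟨⟨s, hs⟩, rfl⟩)
  let L (N : LieSubmodule E g M) :
      {p : Submodule E (rees E g M S ⧸ symbols E g M S ⊥) //
        ∀ x, ∀ v ∈ p, grLie E g M S x v ∈ p} :=
    ⟨(symbols E g M S N).map (symbols E g M S ⊥).mkQ, by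
      rintro x _ ⟨f, hf, rfl⟩
      exact ⟨_, reesLie_mem_symbols E g S N x hf, rfl⟩⟩
  have hL : StrictMono L := by
    intro N N' h
    have h' : (N : Submodule E M) ≤ N' := h.le
    refine lt_of_le_not_ge (Submodule.map_mono (symbols_mono E g S h')) fun hle => ?_
    have h2 := Submodule.comap_mono (f := (symbols E g M S ⊥).mkQ)
      (show (L N').1 ≤ (L N).1 from hle)
    simp only [L, comap_map_symbols] at h2
    exact h.not_ge (le_of_symbols_le E g S hS h' h2)
  exact hL.wellFoundedGT

theorem isFG_of_wellFoundedGT [WellFoundedGT (LieSubmodule E g M)] : IsFG E g M := by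
  obtain ⟨N, ⟨S, rfl⟩, hN⟩ := wellFounded_gt.has_min
    (Set.range fun S : Finset M => LieSubmodule.lieSpan E g (S : Set M)) ⟨_, ∅, rfl⟩
  classical
  refine ⟨S, eq_top_iff.2 fun m _ => ?_⟩
  by_contra hm
  refine hN _ ⟨insert m S, rfl⟩ (lt_of_le_not_ge
    (LieSubmodule.lieSpan_mono (by simp)) fun h => hm (h ?_))
  exact LieSubmodule.subset_lieSpan (by simp)

theorem IsFG.lieSubmodule [Module.Finite E g] (hM : IsFG E g M) (N : LieSubmodule E g M) :
    IsFG E g N := by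
  have := hM.wellFoundedGT
  have hmono : StrictMono (LieSubmodule.map N.incl) :=
    Monotone.strictMono_of_injective (fun _ _ h => LieSubmodule.map_mono h)
      (LieSubmodule.map_injective_of_injective N.injective_incl)
  have := hmono.wellFoundedGT
  exact isFG_of_wellFoundedGT E g

end Noetherian

section Truncation

variable {M : Type} [AddCommGroup M] [Module E M] [LieRingModule g M] [LieModule E g M]

theorem mem_wsp {i : ℕ} {χ : Module.Dual E ↥t} {m : M} :
    m ∈ wsp E g t M i χ ↔
      ∀ h : t, ((LieModule.toEnd E g M (h : g) - χ h • (1 : Module.End E M)) ^ i) m = 0 := by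
  simp [wsp]

theorem wsp_mono (χ : Module.Dual E ↥t) : Monotone fun i => wsp E g t M i χ := by
  intro i j hij m hm
  rw [mem_wsp] at hm ⊢
  intro h
  obtain ⟨k, rfl⟩ := Nat.exists_eq_add_of_le' hij
  rw [pow_add, Module.End.mul_apply, hm h, map_zero]

theorem wsp_le_gwsp (i : ℕ) (χ : Module.Dual E ↥t) : wsp E g t M i χ ≤ gwsp E g t M χ :=
  le_iSup (fun i => wsp E g t M i χ) i

theorem iSup_weights_wsp (i : ℕ) :
    (⨆ χ ∈ weights E g t M, wsp E g t M i χ) = ⨆ χ, wsp E g t M i χ := by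
  refine le_antisymm (iSup_mono fun χ => iSup_le fun _ => le_rfl) (iSup_le fun χ => ?_)
  by_cases h : χ ∈ weights E g t M
  · exact le_iSup₂_of_le χ h le_rfl
  · have h' : gwsp E g t M χ = ⊥ := not_not.1 h
    exact ((wsp_le_gwsp E g t i χ).trans h'.le).trans bot_le

theorem lie_mem_wsp_add {i : ℕ} {α χ : Module.Dual E ↥t} {x : g} (hx : x ∈ rootSp E g t α)
    {m : M} (hm : m ∈ wsp E g t M i χ) : ⁅x, m⁆ ∈ wsp E g t M i (χ + α) := by
  rw [mem_wsp] at hm ⊢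
  intro h
  have hx' : ⁅(h : g), x⁆ = α h • x := by
    simpa [rootSp, sub_eq_zero] using (Submodule.mem_iInf _).1 hx h
  have hsemi : SemiconjBy (LieModule.toEnd E g M x)
      (LieModule.toEnd E g M (h : g) - χ h • (1 : Module.End E M))
      (LieModule.toEnd E g M (h : g) - (χ + α) h • (1 : Module.End E M)) := by
    refine LinearMap.ext fun v => ?_
    have hv : ⁅(h : g), ⁅x, v⁆⁆ = α h • ⁅x, v⁆ + ⁅x, ⁅(h : g), v⁆⁆ := by
      rw [leibniz_lie, hx', smul_lie]
    simp only [Module.End.mul_apply, LinearMap.sub_apply, LinearMap.smul_apply,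
      Module.End.one_apply, LieModule.toEnd_apply_apply, hv, LinearMap.add_apply, add_smul,
      lie_sub, lie_smul]
    abel
  have := LinearMap.congr_fun (hsemi.pow_right i).eq m
  simp only [Module.End.mul_apply, hm h, map_zero] at this
  exact this.symm

theorem lie_mem_wsp_of_mem (habel : IsLieAbelian ↥t) {i : ℕ} {χ : Module.Dual E ↥t} {x : g}
    (hx : x ∈ t) {m : M} (hm : m ∈ wsp E g t M i χ) : ⁅x, m⁆ ∈ wsp E g t M i χ := by
  have hx0 : x ∈ rootSp E g t 0 := by
    refine (Submodule.mem_iInf _).2 fun h => ?_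
    have h0 : ⁅(h : g), x⁆ = 0 := congrArg Subtype.val (habel.trivial h ⟨x, hx⟩)
    simpa using h0
  simpa using lie_mem_wsp_add E g t hx0 hm

variable (M) in
/-- The Lie submodule `⨁ M^i_χ`. -/
def truncation (habel : IsLieAbelian ↥t) (Φ : Finset (Module.Dual E ↥t))
    (hcartan : t.toSubmodule ⊔ (⨆ α ∈ Φ, rootSp E g t α) = ⊤) (i : ℕ) : LieSubmodule E g M :=
  { (⨆ χ, wsp E g t M i χ : Submodule E M) with
    lie_mem := by
      intro x m hm
      change m ∈ ⨆ χ, wsp E g t M i χ at hm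
      change ⁅x, m⁆ ∈ ⨆ χ, wsp E g t M i χ
      have hle : t.toSubmodule ⊔ (⨆ α ∈ Φ, rootSp E g t α) ≤
          (⨆ χ, wsp E g t M i χ).comap ((LieModule.toEnd E g M : g →ₗ[E] Module.End E M).flip m) := by
        induction hm using Submodule.iSup_induction' with
        | mem χ m hm =>
          refine sup_le (fun y hy => ?_) (iSup₂_le fun α _ y hy => ?_)
          · exact Submodule.mem_iSup_of_mem χ (lie_mem_wsp_of_mem E g t habel hy hm)
          · exact Submodule.mem_iSup_of_mem (χ + α) (lie_mem_wsp_add E g t hy hm)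
        | zero => intro y _; simp
        | add m m' _ _ h h' =>
          intro y hy
          rw [Submodule.mem_comap, map_add]
          exact Submodule.add_mem _ (h hy) (h' hy)
      exact hle (hcartan ▸ Submodule.mem_top) }

theorem wsp_lieSubmodule (N : LieSubmodule E g M) (i : ℕ) (χ : Module.Dual E ↥t) :
    wsp E g t N i χ = (wsp E g t M i χ).comap (N : Submodule E M).subtype := by
  ext m
  rw [Submodule.mem_comap, mem_wsp, mem_wsp]
  refine forall_congr' fun h => ?_
  have hs : ∀ n : N, (((LieModule.toEnd E g N (h : g) - χ h • (1 : Module.End E N)) ^ i) n : M) =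
      ((LieModule.toEnd E g M (h : g) - χ h • (1 : Module.End E M)) ^ i) n := by
    induction i with
    | zero => simp
    | succ i ih =>
      intro n
      rw [pow_succ, pow_succ, Module.End.mul_apply, Module.End.mul_apply, ih]
      simp
  rw [← Subtype.coe_injective.eq_iff, hs]
  rfl

theorem gwsp_lieSubmodule_le (N : LieSubmodule E g M) (χ : Module.Dual E ↥t) :
    gwsp E g t N χ ≤ (gwsp E g t M χ).comap (N : Submodule E M).subtype :=
  iSup_le fun i => (wsp_lieSubmodule E g t N i χ).le.trans
    (Submodule.comap_mono (wsp_le_gwsp E g t i χ))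

theorem IsESplit.iSupIndep (h : IsESplit E g t M) : iSupIndep fun χ => gwsp E g t M χ := by
  classical
  exact DirectSum.IsInternal.submodule_iSupIndep h

theorem IsESplit.iSup_eq_top (h : IsESplit E g t M) : ⨆ χ, gwsp E g t M χ = ⊤ := by
  classical
  exact DirectSum.IsInternal.submodule_iSup_eq_top h

theorem IsESplit.iSupIndep_lieSubmodule (h : IsESplit E g t M) (N : LieSubmodule E g M) :
    _root_.iSupIndep fun χ => gwsp E g t N χ := by
  have h1 : _root_.iSupIndep fun χ => (gwsp E g t N χ).map (N : Submodule E M).subtype :=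
    (IsESplit.iSupIndep E g t h).mono fun χ =>
      Submodule.map_le_iff_le_comap.2 (gwsp_lieSubmodule_le E g t N χ)
  intro χ
  have h2 := h1 χ
  simp only [← Submodule.map_iSup] at h2
  rw [disjoint_iff, ← Submodule.map_inf _ (N : Submodule E M).injective_subtype] at h2
  exact disjoint_iff.2 (Submodule.map_injective_of_injective
    (N : Submodule E M).injective_subtype (h2.trans (Submodule.map_bot _).symm))

theorem iSup_wsp_lieSubmodule (N : LieSubmodule E g M) (i : ℕ)
    (hN : (N : Submodule E M) = ⨆ χ, wsp E g t M i χ) : ⨆ χ, wsp E g t N i χ = ⊤ := by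
  apply Submodule.map_injective_of_injective (N : Submodule E M).injective_subtype
  rw [Submodule.map_iSup, Submodule.map_subtype_top]
  simp only [wsp_lieSubmodule, Submodule.map_comap_subtype]
  conv_rhs => rw [hN]
  refine iSup_congr fun χ => inf_eq_right.2 ?_
  exact hN ▸ le_iSup (fun χ => wsp E g t M i χ) χ

theorem IsLocBFinite.lieSubmodule (h : IsLocBFinite E g b M) (N : LieSubmodule E g M) :
    IsLocBFinite E g b N := by
  intro m
  obtain ⟨W, hW, hm, hbW⟩ := h m
  refine ⟨W.comap (N : Submodule E M).subtype, ?_, hm, fun x w hw => hbW x _ hw⟩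
  exact Module.Finite.of_injective
    ((N : Submodule E M).subtype.restrict (q := W) fun _ hx => hx)
    fun x y h => Subtype.ext (Subtype.ext (congrArg (fun w : W => (w : M)) h))

theorem InCatOInf.truncation_inCatOInf [Module.Finite E g] (hM : InCatOInf E g t b M)
    (N : LieSubmodule E g M) (i : ℕ) (hN : (N : Submodule E M) = ⨆ χ, wsp E g t M i χ) :
    InCatOInf E g t b N := by
  refine ⟨hM.1.lieSubmodule E g N, ?_, hM.2.2.lieSubmodule E g b N⟩
  classical
  refine (DirectSum.isInternal_submodule_iff_iSupIndep_and_iSup_eq_top _).2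
    ⟨hM.2.1.iSupIndep_lieSubmodule E g t N, eq_top_iff.2 ?_⟩
  rw [← iSup_wsp_lieSubmodule E g t N i hN]
  exact iSup_mono fun χ => wsp_le_gwsp E g t i χ

theorem InCatOInf.truncation_inCatO [Module.Finite E g] (hM : InCatOInf E g t b M)
    (N : LieSubmodule E g M) (hN : (N : Submodule E M) = ⨆ χ, wsp E g t M 1 χ) :
    InCatO E g t b N := by
  refine ⟨hM.1.lieSubmodule E g N, ?_, hM.2.2.lieSubmodule E g b N⟩
  classical
  exact (DirectSum.isInternal_submodule_iff_iSupIndep_and_iSup_eq_top _).2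
    ⟨(hM.2.1.iSupIndep_lieSubmodule E g t N).mono fun χ => wsp_le_gwsp E g t 1 χ,
      iSup_wsp_lieSubmodule E g t N 1 hN⟩

/-- The commuting nilpotent operators `h - χ(h)` on `M^i_χ` have a common kernel vector. -/
theorem exists_ne_zero_mem_wsp_one [Module.Finite E g] (habel : IsLieAbelian ↥t) {i : ℕ}
    {χ : Module.Dual E ↥t} {m : M} (hm : m ∈ wsp E g t M i χ) (hm0 : m ≠ 0) :
    ∃ m' ∈ wsp E g t M 1 χ, m' ≠ 0 := by
  classical
  let D : t →ₗ[E] Module.End E M :=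
    (LieModule.toEnd E g M : g →ₗ[E] _) ∘ₗ t.toSubmodule.subtype - χ.smulRight 1
  have hD (h : t) : D h = LieModule.toEnd E g M (h : g) - χ h • (1 : Module.End E M) := rfl
  have hstab (h : t) : ∀ v ∈ wsp E g t M i χ, D h v ∈ wsp E g t M i χ := fun v hv =>
    Submodule.sub_mem _ (lie_mem_wsp_of_mem E g t habel h.2 hv) (Submodule.smul_mem _ _ hv)
  have hcomm (h k : t) : Commute (D h) (D k) := by
    have h0 : ⁅(h : g), (k : g)⁆ = 0 := congrArg Subtype.val (habel.trivial h k)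
    have h1 : Commute (LieModule.toEnd E g M (h : g)) (LieModule.toEnd E g M (k : g)) := by
      refine LinearMap.ext fun v => ?_
      have hv := leibniz_lie (h : g) (k : g) v
      rw [h0, zero_lie, zero_add] at hv
      exact hv
    simp only [hD]
    exact (h1.sub_left ((Commute.one_left _).smul_left _)).sub_right
      ((Commute.one_right _).smul_right _)
  have key (B : Finset t) : ∃ v ∈ wsp E g t M i χ, v ≠ 0 ∧ ∀ h ∈ B, D h v = 0 := by
    induction B using Finset.induction_on with
    | empty => exact ⟨m, hm, hm0, by simp⟩
    | insert k B _ ih =>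
      obtain ⟨v, hv, hv0, hB⟩ := ih
      have hex : ∃ n, (D k ^ n) v = 0 := ⟨i, (mem_wsp E g t).1 hv k⟩
      have hpos : Nat.find hex ≠ 0 := fun h => hv0 (by simpa [h] using Nat.find_spec hex)
      obtain ⟨n, hn⟩ := Nat.exists_eq_succ_of_ne_zero hpos
      refine ⟨(D k ^ n) v, ?_, Nat.find_min hex (by omega), ?_⟩
      · clear hn
        induction n with
        | zero => simpa using hv
        | succ n ihn => rw [pow_succ', Module.End.mul_apply]; exact hstab k _ ihn
      · intro h hh
        rcases Finset.mem_insert.1 hh with rfl | hh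
        · rw [← Module.End.mul_apply, ← pow_succ', ← Nat.succ_eq_add_one, ← hn]
          exact Nat.find_spec hex
        · rw [← Module.End.mul_apply, ((hcomm h k).pow_right n).eq, Module.End.mul_apply,
            hB h hh, map_zero]
  have : Module.Finite E t := inferInstanceAs (Module.Finite E t.toSubmodule)
  obtain ⟨B, hB⟩ := Module.Finite.fg_top (R := E) (M := t)
  obtain ⟨v, -, hv0, hv⟩ := key B
  refine ⟨v, (mem_wsp E g t).2 fun h => ?_, hv0⟩
  have hle : Submodule.span E (B : Set t) ≤ LinearMap.ker (D.flip v) :=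
    Submodule.span_le.2 fun k hk => hv k hk
  rw [pow_one]
  exact hle (hB ▸ Submodule.mem_top)

theorem IsESplit.iSup_wsp_one_ne_bot [Module.Finite E g] (habel : IsLieAbelian ↥t)
    (hM : IsESplit E g t M) {m : M} (hm : m ≠ 0) : (⨆ χ, wsp E g t M 1 χ) ≠ ⊥ := by
  intro hbot
  have hw1 : ∀ χ, wsp E g t M 1 χ = ⊥ := iSup_eq_bot.1 hbot
  have hw (i : ℕ) (χ : Module.Dual E ↥t) : wsp E g t M i χ = ⊥ := by
    refine (Submodule.eq_bot_iff _).2 fun v hv => ?_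
    by_contra hv0
    obtain ⟨w, hw, hw0⟩ := exists_ne_zero_mem_wsp_one E g t habel hv hv0
    exact hw0 (by simpa [hw1] using hw)
  have htop := IsESplit.iSup_eq_top E g t hM
  simp only [gwsp, hw, iSup_bot] at htop
  exact hm ((Submodule.mem_bot E).1 (htop.symm ▸ Submodule.mem_top))

theorem IsESplit.exists_mem_iSup_wsp (hM : IsESplit E g t M) (m : M) :
    ∃ i, m ∈ ⨆ χ, wsp E g t M i χ := by
  have hmono : Monotone fun i => ⨆ χ, wsp E g t M i χ :=
    fun i j hij => iSup_mono fun χ => wsp_mono E g t χ hij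
  have hm : m ∈ ⨆ i, ⨆ χ, wsp E g t M i χ := by
    rw [iSup_comm]
    exact (IsESplit.iSup_eq_top E g t hM) ▸ Submodule.mem_top
  exact (Submodule.mem_iSup_of_directed _ hmono.directed_le).1 hm

end Truncation

/-- for `M ∈ O^∞` and `i ≥ 1` let `M^i = ⊕_{λ ∈ Π(M)} M^i_λ`.  Then
(a) each `M^i` is a `U(g)`-submodule of `M` belonging to `O^∞`;
(b) `M^1` is a submodule lying in category `O`, non-zero whenever `M ≠ 0`;
(c) `M = M^i` for some `i > 0`. -/
theorem filtration_by_truncated_weight_spaces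
    (E : Type) [Field E] [CharZero E]
    (g : Type) [LieRing g] [LieAlgebra E g] [Module.Finite E g]
    (t b : LieSubalgebra E g)
    (htb : t ≤ b) (habel : IsLieAbelian ↥t)
    (Φ Φp : Finset (Module.Dual E ↥t))
    (hΦ0 : (0 : Module.Dual E ↥t) ∉ Φ)
    (hcartan : t.toSubmodule ⊔ (⨆ α ∈ Φ, rootSp E g t α) = ⊤)
    (hΦp : ∀ α, α ∈ Φp ↔ α ∈ Φ ∧ rootSp E g t α ≤ b.toSubmodule)
    (hborel : t.toSubmodule ⊔ (⨆ α ∈ Φp, rootSp E g t α) = b.toSubmodule)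
    (hsplit : ∀ α ∈ Φ, α ∈ Φp ∨ -α ∈ Φp)
    (M : Type) [AddCommGroup M] [Module E M] [LieRingModule g M] [LieModule E g M]
    (hM : InCatOInf E g t b M) :
    (∀ i : ℕ, 1 ≤ i → ∃ N : LieSubmodule E g M,
        (N : Submodule E M) = (⨆ χ ∈ weights E g t M, wsp E g t M i χ) ∧
        InCatOInf E g t b ↥N) ∧
    (∃ N₁ : LieSubmodule E g M,
        (N₁ : Submodule E M) = (⨆ χ ∈ weights E g t M, wsp E g t M 1 χ) ∧
        InCatO E g t b ↥N₁ ∧ ((∃ m : M, m ≠ 0) → N₁ ≠ ⊥)) ∧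
    (∃ i : ℕ, 0 < i ∧
        (⨆ χ ∈ weights E g t M, wsp E g t M i χ) = (⊤ : Submodule E M)) := by
  have hwt := iSup_weights_wsp E g t (M := M)
  simp only [hwt]
  refine ⟨fun i _ => ⟨truncation E g t M habel Φ hcartan i, rfl,
    hM.truncation_inCatOInf E g t b _ i rfl⟩,
    ⟨truncation E g t M habel Φ hcartan 1, rfl, hM.truncation_inCatO E g t b _ rfl, ?_⟩, ?_⟩
  · rintro ⟨m, hm⟩ hbot
    refine hM.2.1.iSup_wsp_one_ne_bot E g t habel hm ?_
    exact congrArg LieSubmodule.toSubmodule hbot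
  · obtain ⟨S, hS⟩ := hM.1
    choose d hd using hM.2.1.exists_mem_iSup_wsp E g t
    refine ⟨S.sup d + 1, Nat.succ_pos _, ?_⟩
    have hle : LieSubmodule.lieSpan E g (S : Set M) ≤
        truncation E g t M habel Φ hcartan (S.sup d + 1) := by
      rw [LieSubmodule.lieSpan_le]
      intro s hs
      have hds : d s ≤ S.sup d + 1 := (Finset.le_sup hs).trans (Nat.le_succ _)
      exact iSup_mono (fun χ => wsp_mono E g t χ hds) (hd s)
    rw [hS] at hle
    exact eq_top_iff.2 fun m _ => hle (LieSubmodule.mem_top m)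

end PaperO
end
end

section
/- Let g = sl(2,F) with standard basis x, y, h and Borel subalgebra b = Fh ⊕ Fx, and fix λ ∈ F. Let N = Fe_1 ⊕ Fe_2 be the two-dimensional U(b)-module on which x acts as 0 and h acts by h·e_1 = λe_1 and h·e_2 = e_1 + λe_2, and set M = U(g) ⊗_{U(b)} N. Then there is a short exact sequence of U(g)-modules 0 → M(λ) → M → M(λ) → 0 which does not split. In particular, M is a non-split self-extension of the Verma module M(λ), so category O is not closed under extensions in the category of U(g)-modules. -/
noncomputable section

namespace PaperO

/-!
STATEMENT 18: Let `g = sl(2,F)` with standard basis `X, Y, H` and Borel subalgebra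
`b = F·H ⊕ F·X`, and fix `λ ∈ F`.  Let `N = F·e₁ ⊕ F·e₂` be the two-dimensional
`U(b)`-module on which `X` acts as `0` and `H` acts by `H·e₁ = λ·e₁`,
`H·e₂ = e₁ + λ·e₂`, and let `M = U(g) ⊗_{U(b)} N` be the induced module.  Then there
is a short exact sequence of `U(g)`-modules `0 → M(λ) → M → M(λ) → 0` which does not
split; in particular `M` is a non-split self-extension of the Verma module `M(λ)`,
so category `O` is not closed under extensions.

Here `sl(2,F)` is presented as a Lie algebra with basis `X, Y, H` satisfying the
standard relations, the induced module `U(g) ⊗_{U(b)} N` is characterized by its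
universal property, and the Verma module `M(λ)` by its universal property.
-/

variable (F : Type) [Field F] [CharZero F]
variable (g : Type) [LieRing g] [LieAlgebra F g]

/-- `v` is a highest weight vector of weight `λ` for the `sl₂`-data `(X, H)`. -/
def IsHWVector (X H : g) (lam : F)
    (P : Type) [AddCommGroup P] [Module F P] [LieRingModule g P] (w : P) : Prop :=
  ⁅H, w⁆ = lam • w ∧ ⁅X, w⁆ = 0

/-- `(V, v)` is the Verma module `M(λ)` for `sl₂ = ⟨X,Y,H⟩`: `v` is a highest weight
vector of weight `λ` generating `V` freely, expressed by the universal property: any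
highest weight vector of weight `λ` in any `g`-module receives a unique map. -/
def IsVermaSl2 (X H : g) (lam : F)
    (V : Type) [AddCommGroup V] [Module F V] [LieRingModule g V] [LieModule F g V]
    (v : V) : Prop :=
  IsHWVector F g X H lam V v ∧
  ∀ (P : Type) [AddCommGroup P] [Module F P] [LieRingModule g P] [LieModule F g P],
    ∀ w : P, IsHWVector F g X H lam P w →
      ∃! f : V →ₗ⁅F,g⁆ P, f v = w

/-- `(M, j)` is the induced module `U(g) ⊗_{U(b)} N` of the `b`-module `N`, expressed
by the universal property of induction. -/
def IsInducedFrom (b : LieSubalgebra F g)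
    (N : Type) [AddCommGroup N] [Module F N] [LieRingModule (↥b) N] [LieModule F (↥b) N]
    (M : Type) [AddCommGroup M] [Module F M] [LieRingModule g M] [LieModule F g M]
    (j : N →ₗ[F] M) : Prop :=
  (∀ (x : ↥b) (n : N), j ⁅x, n⁆ = ⁅(x : g), j n⁆) ∧
  ∀ (P : Type) [AddCommGroup P] [Module F P] [LieRingModule g P] [LieModule F g P],
    ∀ φ : N →ₗ[F] P, (∀ (x : ↥b) (n : N), φ ⁅x, n⁆ = ⁅(x : g), φ n⁆) →
      ∃! f : M →ₗ⁅F,g⁆ P, ∀ n : N, f (j n) = φ n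

section Sl2Representations

open Polynomial

attribute [local instance] LieRing.ofAssociativeRing

variable {F : Type} [Field F] {g : Type} [LieRing g] [LieAlgebra F g]

/-- Elements of a Lie algebra satisfying the `sl₂` relations are the images of the standard basis
under a homomorphism from `sl₂`. -/
lemma exists_lieHom_of_sl2_relations {X Y H : g}
    (hbasis : LinearIndependent F ![X, Y, H]) (hspan : Submodule.span F {X, Y, H} = ⊤)
    (hHX : ⁅H, X⁆ = (2 : F) • X) (hHY : ⁅H, Y⁆ = (-2 : F) • Y) (hXY : ⁅X, Y⁆ = H)
    {A : Type} [LieRing A] [LieAlgebra F A] {x y h : A}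
    (hhx : ⁅h, x⁆ = (2 : F) • x) (hhy : ⁅h, y⁆ = (-2 : F) • y) (hxy : ⁅x, y⁆ = h) :
    ∃ ρ : g →ₗ⁅F⁆ A, ρ X = x ∧ ρ Y = y ∧ ρ H = h := by
  have hrange : Set.range ![X, Y, H] = {X, Y, H} := by
    ext a
    simp only [Matrix.range_cons, Matrix.range_empty, Set.union_empty, Set.mem_union,
      Set.mem_singleton_iff, Set.mem_insert_iff]
  let B : Module.Basis (Fin 3) F g := Module.Basis.mk hbasis (by rw [hrange, hspan])
  let φ : g →ₗ[F] A := B.constr F ![x, y, h]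
  have hφX : φ X = x := by simpa [B, φ] using B.constr_basis F ![x, y, h] 0
  have hφY : φ Y = y := by simpa [B, φ] using B.constr_basis F ![x, y, h] 1
  have hφH : φ H = h := by simpa [B, φ] using B.constr_basis F ![x, y, h] 2
  have hXH : ⁅X, H⁆ = -((2 : F) • X) := by rw [← lie_skew, hHX]
  have hYH : ⁅Y, H⁆ = -((-2 : F) • Y) := by rw [← lie_skew, hHY]
  have hYX : ⁅Y, X⁆ = -H := by rw [← lie_skew, hXY]
  have hxh : ⁅x, h⁆ = -((2 : F) • x) := by rw [← lie_skew, hhx]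
  have hyh : ⁅y, h⁆ = -((-2 : F) • y) := by rw [← lie_skew, hhy]
  have hyx : ⁅y, x⁆ = -h := by rw [← lie_skew, hxy]
  have hmap : ∀ a b : g, φ ⁅a, b⁆ = ⁅φ a, φ b⁆ := by
    intro a b
    have ha : a ∈ Submodule.span F {X, Y, H} := hspan ▸ Submodule.mem_top
    have hb : b ∈ Submodule.span F {X, Y, H} := hspan ▸ Submodule.mem_top
    induction ha, hb using Submodule.span_induction₂ with
    | mem_mem a b ha hb =>
      rcases ha with rfl | rfl | rfl <;> rcases hb with rfl | rfl | rfl <;>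
        simp only [lie_self, map_zero, map_neg, map_smul, *]
    | zero_left => simp
    | zero_right => simp
    | add_left a b c _ _ _ h₁ h₂ => simp [h₁, h₂]
    | add_right a b c _ _ _ h₁ h₂ => simp [h₁, h₂]
    | smul_left r a b _ _ h => simp [h]
    | smul_right r a b _ _ h => simp [h]
  exact ⟨{ φ with map_lie' := hmap _ _ }, hφX, hφY, hφH⟩

/-- The Verma module with highest weight `Λ` in a commutative `F`-algebra `R` is realised on `R[X]`:
`Y` is multiplication by the variable and `1` is a highest weight vector. -/
lemma exists_polynomial_rep {X Y H : g}
    (hbasis : LinearIndependent F ![X, Y, H]) (hspan : Submodule.span F {X, Y, H} = ⊤)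
    (hHX : ⁅H, X⁆ = (2 : F) • X) (hHY : ⁅H, Y⁆ = (-2 : F) • Y) (hXY : ⁅X, Y⁆ = H)
    {R : Type} [CommRing R] [Algebra F R] (Λ : R) :
    ∃ ρ : g →ₗ⁅F⁆ Module.End F R[X],
      (∀ p, ρ X p = C Λ * derivative p - Polynomial.X * derivative (derivative p)) ∧
      (∀ p, ρ Y p = Polynomial.X * p) ∧
      (∀ p, ρ H p = C Λ * p - 2 * (Polynomial.X * derivative p)) := by
  let D : Module.End F R[X] := (derivative : R[X] →ₗ[R] R[X]).restrictScalars F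
  let t : Module.End F R[X] := LinearMap.mulLeft F Polynomial.X
  let c : Module.End F R[X] := LinearMap.mulLeft F (C Λ)
  have hsmul : ∀ p : R[X], (2 : F) • p = 2 * p := fun p ↦ by rw [two_smul, two_mul]
  obtain ⟨ρ, hX, hY, hH⟩ := exists_lieHom_of_sl2_relations hbasis hspan hHX hHY hXY
    (x := c * D - t * (D * D)) (y := t) (h := c - (2 : F) • (t * D))
    (by
      refine LinearMap.ext fun p ↦ ?_
      simp only [Ring.lie_def, D, t, c, LinearMap.sub_apply, LinearMap.smul_apply,
        Module.End.mul_apply, LinearMap.mulLeft_apply, LinearMap.restrictScalars_apply, hsmul]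
      simp only [derivative_mul, derivative_sub, derivative_add, derivative_C, derivative_X,
        derivative_one, derivative_ofNat, derivative_zero]
      ring)
    (by
      refine LinearMap.ext fun p ↦ ?_
      simp only [Ring.lie_def, D, t, c, LinearMap.sub_apply, LinearMap.smul_apply,
        Module.End.mul_apply, LinearMap.mulLeft_apply, LinearMap.restrictScalars_apply, neg_smul,
        LinearMap.neg_apply, hsmul, derivative_mul, derivative_X]
      ring)
    (by
      refine LinearMap.ext fun p ↦ ?_
      simp only [Ring.lie_def, D, t, c, LinearMap.sub_apply, LinearMap.smul_apply,
        Module.End.mul_apply, LinearMap.mulLeft_apply, LinearMap.restrictScalars_apply, hsmul,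
        derivative_mul, derivative_add, derivative_X, derivative_one]
      ring)
  refine ⟨ρ, fun p ↦ ?_, fun p ↦ ?_, fun p ↦ ?_⟩
  · rw [hX]; rfl
  · rw [hY]; rfl
  · rw [hH, ← hsmul]; rfl

lemma aeval_mulLeft_X {R : Type} [CommRing R] [Algebra F R] (p : F[X]) (w : R[X]) :
    aeval (LinearMap.mulLeft F (Polynomial.X : R[X])) p w = p.map (algebraMap F R) * w := by
  induction p using Polynomial.induction_on' with
  | add p q hp hq => simp [hp, hq, add_mul]
  | monomial n a =>
    rw [aeval_monomial, Module.End.mul_apply, LinearMap.pow_mulLeft, LinearMap.mulLeft_apply,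
      Module.algebraMap_end_apply, map_monomial, ← C_mul_X_pow_eq_monomial, mul_assoc,
      Algebra.smul_def]
    rfl

lemma map_aeval_end {P Q : Type} [AddCommGroup P] [Module F P] [AddCommGroup Q] [Module F Q]
    (φ : P →ₗ[F] Q) {S : Module.End F P} {T : Module.End F Q} (hφ : ∀ m, φ (S m) = T (φ m))
    (p : F[X]) (m : P) : φ (aeval S p m) = aeval T p (φ m) := by
  induction p using Polynomial.induction_on generalizing m with
  | C a => simp
  | add p q hp hq => simp [hp, hq]
  | monomial n a h =>
    rw [pow_succ, ← mul_assoc, map_mul (aeval S), map_mul (aeval T), Module.End.mul_apply,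
      Module.End.mul_apply, h, aeval_X, aeval_X, hφ]

/-- A linear map commutes with the action of a Lie subalgebra as soon as it commutes with
generators. -/
lemma map_lie_of_lieSpan {s : Set g} {b : LieSubalgebra F g} (hb : b = LieSubalgebra.lieSpan F g s)
    {N : Type} [AddCommGroup N] [Module F N] [LieRingModule b N] [LieModule F b N]
    {P : Type} [AddCommGroup P] [Module F P] [LieRingModule g P] [LieModule F g P]
    (φ : N →ₗ[F] P) (hφ : ∀ x : b, (x : g) ∈ s → ∀ n, φ ⁅x, n⁆ = ⁅(x : g), φ n⁆)
    (x : b) (n : N) : φ ⁅x, n⁆ = ⁅(x : g), φ n⁆ := by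
  obtain ⟨x, hx⟩ := x
  have hx' : x ∈ LieSubalgebra.lieSpan F g s := hb ▸ hx
  have key : ∃ h : x ∈ b, ∀ n, φ ⁅(⟨x, h⟩ : b), n⁆ = ⁅x, φ n⁆ := by
    clear hx
    induction hx' using LieSubalgebra.lieSpan_induction with
    | mem x h =>
      have hxb : x ∈ b := hb ▸ LieSubalgebra.subset_lieSpan h
      exact ⟨hxb, hφ ⟨x, hxb⟩ h⟩
    | zero =>
      refine ⟨b.zero_mem, fun n ↦ ?_⟩
      rw [show (⟨0, b.zero_mem⟩ : b) = 0 from rfl, zero_lie, zero_lie, map_zero]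
    | add x y hxs hys ihx ihy =>
      obtain ⟨hx, ihx⟩ := ihx
      obtain ⟨hy, ihy⟩ := ihy
      refine ⟨b.add_mem hx hy, fun n ↦ ?_⟩
      rw [show (⟨x + y, b.add_mem hx hy⟩ : b) = ⟨x, hx⟩ + ⟨y, hy⟩ from rfl, add_lie, add_lie,
        map_add, ihx, ihy]
    | smul a x hxs ihx =>
      obtain ⟨hx, ihx⟩ := ihx
      refine ⟨b.smul_mem a hx, fun n ↦ ?_⟩
      rw [show (⟨a • x, b.smul_mem a hx⟩ : b) = a • ⟨x, hx⟩ from rfl, smul_lie, smul_lie,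
        map_smul, ihx]
    | lie x y hxs hys ihx ihy =>
      obtain ⟨hx, ihx⟩ := ihx
      obtain ⟨hy, ihy⟩ := ihy
      refine ⟨b.lie_mem hx hy, fun n ↦ ?_⟩
      rw [show (⟨⁅x, y⁆, b.lie_mem hx hy⟩ : b) = ⁅(⟨x, hx⟩ : b), (⟨y, hy⟩ : b)⁆ from rfl,
        lie_lie, lie_lie, map_sub, ihx, ihy, ihy, ihx]
  exact key.choose_spec n

section Verma

variable {X Y H : g} {lam : F} {V : Type} [AddCommGroup V] [Module F V] [LieRingModule g V]
  [LieModule F g V] {v : V}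

lemma IsVermaSl2.hom_ext (hV : IsVermaSl2 F g X H lam V v)
    {P : Type} [AddCommGroup P] [Module F P] [LieRingModule g P] [LieModule F g P]
    {f₁ f₂ : V →ₗ⁅F,g⁆ P} (h : f₁ v = f₂ v) : f₁ = f₂ := by
  have hw : IsHWVector F g X H lam P (f₂ v) := by
    constructor
    · rw [← LieModuleHom.map_lie, hV.1.1, map_smul]
    · rw [← LieModuleHom.map_lie, hV.1.2, map_zero]
  exact (hV.2 P (f₂ v) hw).unique h rfl

lemma IsVermaSl2.exists_intertwiner (hV : IsVermaSl2 F g X H lam V v)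
    {P : Type} [AddCommGroup P] [Module F P] (ρ : g →ₗ⁅F⁆ Module.End F P) (w : P)
    (hH : ρ H w = lam • w) (hX : ρ X w = 0) :
    ∃ f : V →ₗ[F] P, f v = w ∧ ∀ a m, f ⁅a, m⁆ = ρ a (f m) := by
  let : LieRingModule g P := LieRingModule.compLieHom P ρ
  have : LieModule F g P := LieModule.compLieHom P ρ
  obtain ⟨f, hf, -⟩ := hV.2 P w ⟨hH, hX⟩
  exact ⟨f, hf, fun a m ↦ f.map_lie a m⟩

/-- Every vector of a Verma module is a polynomial in `Y` applied to the highest weight vector;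
`r` reads off that polynomial. -/
lemma IsVermaSl2.exists_coordinates (hV : IsVermaSl2 F g X H lam V v)
    (hspan : Submodule.span F {X, Y, H} = ⊤) (hHY : ⁅H, Y⁆ = (-2 : F) • Y) (hXY : ⁅X, Y⁆ = H)
    (ρ : g →ₗ⁅F⁆ Module.End F F[X])
    (hX : ∀ p, ρ X p = C lam * derivative p - Polynomial.X * derivative (derivative p))
    (hY : ∀ p, ρ Y p = Polynomial.X * p)
    (hH : ∀ p, ρ H p = C lam * p - 2 * (Polynomial.X * derivative p)) :
    ∃ r : V →ₗ[F] F[X], r v = 1 ∧ (∀ a m, r ⁅a, m⁆ = ρ a (r m)) ∧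
      ∀ m, aeval (LieModule.toEnd F g V Y) (r m) v = m := by
  obtain ⟨r, hrv, hr⟩ := hV.exists_intertwiner ρ 1 (by simp [hH, smul_eq_C_mul]) (by simp [hX])
  let u : F[X] →ₗ[F] V :=
    (LinearMap.applyₗ v).comp (aeval (LieModule.toEnd F g V Y)).toLinearMap
  have hu : ∀ p, u p = aeval (LieModule.toEnd F g V Y) p v := fun p ↦ rfl
  have huC : ∀ a, u (C a) = a • v := by simp [hu]
  have huY : ∀ p, u (ρ Y p) = ⁅Y, u p⁆ := by simp [hu, hY]
  have hcomm : ∀ a c p, ρ a (ρ c p) = ρ ⁅a, c⁆ p + ρ c (ρ a p) := fun a c p ↦ by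
    simp [LieHom.map_lie, Ring.lie_def]
  have huX_pow : ∀ (n : ℕ) (a : F), C a * Polynomial.X ^ (n + 1) =
      ρ Y (C a * Polynomial.X ^ n) := by
    intro n a
    rw [hY]
    ring
  have huH : ∀ p, u (ρ H p) = ⁅H, u p⁆ := by
    intro p
    induction p using Polynomial.induction_on with
    | C a =>
      rw [hH, derivative_C, mul_zero, mul_zero, sub_zero, ← C_mul, huC, huC, lie_smul, hV.1.1,
        smul_smul, mul_comm]
    | add p q hp hq => simp only [map_add, lie_add, hp, hq]
    | monomial n a ih =>
      rw [huX_pow, hcomm, huY, leibniz_lie H Y, hHY, smul_lie, map_smul, LinearMap.smul_apply,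
        map_add, map_smul, huY, huY, ih]
  have huX : ∀ p, u (ρ X p) = ⁅X, u p⁆ := by
    intro p
    induction p using Polynomial.induction_on with
    | C a => simp [hX, huC, hV.1.2]
    | add p q hp hq => simp only [map_add, lie_add, hp, hq]
    | monomial n a ih =>
      rw [huX_pow, hcomm, huY, leibniz_lie X Y, hXY, map_add, huH, huY, ih]
  have hug : ∀ a p, u (ρ a p) = ⁅a, u p⁆ := by
    intro a p
    have ha : a ∈ Submodule.span F {X, Y, H} := hspan ▸ Submodule.mem_top
    induction ha using Submodule.span_induction with
    | mem a ha =>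
      rcases ha with rfl | rfl | rfl
      exacts [huX p, huY p, huH p]
    | zero => simp
    | add a b _ _ h₁ h₂ => simp [h₁, h₂]
    | smul c a _ h => simp [h]
  let ur : V →ₗ⁅F,g⁆ V :=
    { u.comp r with map_lie' := fun {a m} ↦ (congrArg u (hr a m)).trans (hug a (r m)) }
  have hur : ur = LieModuleHom.id := by
    apply hV.hom_ext
    change u (r v) = v
    rw [hrv, ← C_1, huC, one_smul]
  exact ⟨r, hrv, hr, fun m ↦ DFunLike.congr_fun hur m⟩

end Verma

section Induced

variable {b : LieSubalgebra F g} {N : Type} [AddCommGroup N] [Module F N] [LieRingModule b N]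
  [LieModule F b N] {M : Type} [AddCommGroup M] [Module F M] [LieRingModule g M]
  [LieModule F g M] {j : N →ₗ[F] M}

lemma IsInducedFrom.hom_ext (hM : IsInducedFrom F g b N M j)
    {P : Type} [AddCommGroup P] [Module F P] [LieRingModule g P] [LieModule F g P]
    {f₁ f₂ : M →ₗ⁅F,g⁆ P} (h : ∀ n, f₁ (j n) = f₂ (j n)) : f₁ = f₂ := by
  refine (hM.2 P ((f₂ : M →ₗ[F] P).comp j) fun x n ↦ ?_).unique h fun _ ↦ rfl
  change f₂ (j ⁅x, n⁆) = ⁅(x : g), f₂ (j n)⁆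
  rw [hM.1, LieModuleHom.map_lie]

lemma IsInducedFrom.exists_hom (hM : IsInducedFrom F g b N M j) {s : Set g}
    (hb : b = LieSubalgebra.lieSpan F g s)
    {P : Type} [AddCommGroup P] [Module F P] [LieRingModule g P] [LieModule F g P]
    (φ : N →ₗ[F] P) (hφ : ∀ x : b, (x : g) ∈ s → ∀ n, φ ⁅x, n⁆ = ⁅(x : g), φ n⁆) :
    ∃ f : M →ₗ⁅F,g⁆ P, ∀ n, f (j n) = φ n :=
  (hM.2 P φ (map_lie_of_lieSpan hb φ hφ)).exists

lemma IsInducedFrom.exists_intertwiner (hM : IsInducedFrom F g b N M j) {s : Set g}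
    (hb : b = LieSubalgebra.lieSpan F g s)
    {P : Type} [AddCommGroup P] [Module F P] (ρ : g →ₗ⁅F⁆ Module.End F P)
    (φ : N →ₗ[F] P) (hφ : ∀ x : b, (x : g) ∈ s → ∀ n, φ ⁅x, n⁆ = ρ x (φ n)) :
    ∃ f : M →ₗ[F] P, (∀ n, f (j n) = φ n) ∧ ∀ a m, f ⁅a, m⁆ = ρ a (f m) := by
  let : LieRingModule g P := LieRingModule.compLieHom P ρ
  have : LieModule F g P := LieModule.compLieHom P ρ
  obtain ⟨f, hf⟩ := hM.exists_hom hb φ hφ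
  exact ⟨f, hf, fun a m ↦ f.map_lie a m⟩

end Induced

end Sl2Representations

theorem catO_not_closed_under_extensions_sl2
    (X Y H : g)
    -- X, Y, H is a basis of g satisfying the sl(2) relations
    (hbasis : LinearIndependent F ![X, Y, H])
    (hspan : Submodule.span F {X, Y, H} = ⊤)
    (hHX : ⁅H, X⁆ = (2 : F) • X) (hHY : ⁅H, Y⁆ = (-2 : F) • Y) (hXY : ⁅X, Y⁆ = H)
    -- b is the Borel subalgebra spanned by H and X
    (b : LieSubalgebra F g) (hb : b = LieSubalgebra.lieSpan F g {H, X})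
    (hHb : H ∈ b) (hXb : X ∈ b)
    (lam : F)
    -- N = F e₁ ⊕ F e₂ with X acting by 0, H by H·e₁ = λ e₁, H·e₂ = e₁ + λ e₂
    [LieRingModule (↥b) (F × F)] [LieModule F (↥b) (F × F)]
    (hHact : ∀ z : F × F, ⁅(⟨H, hHb⟩ : ↥b), z⁆ = (lam * z.1 + z.2, lam * z.2))
    (hXact : ∀ z : F × F, ⁅(⟨X, hXb⟩ : ↥b), z⁆ = (0 : F × F))
    -- M = U(g) ⊗_{U(b)} N
    (M : Type) [AddCommGroup M] [Module F M] [LieRingModule g M] [LieModule F g M]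
    (j : (F × F) →ₗ[F] M) (hM : IsInducedFrom F g b (F × F) M j)
    -- V = M(λ) is the Verma module of highest weight λ
    (V : Type) [AddCommGroup V] [Module F V] [LieRingModule g V] [LieModule F g V]
    (v : V) (hV : IsVermaSl2 F g X H lam V v) :
    ∃ (f : V →ₗ⁅F,g⁆ M) (p : M →ₗ⁅F,g⁆ V),
      Function.Injective f ∧ Function.Surjective p ∧ Function.Exact f p ∧
      ¬ ∃ s : V →ₗ⁅F,g⁆ M, p.comp s = LieModuleHom.id := by
  have hφb : ∀ {P : Type} [AddCommGroup P] [Module F P] (ρ : g → P → P) (φ : F × F →ₗ[F] P),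
      (∀ z : F × F, φ (lam * z.1 + z.2, lam * z.2) = ρ H (φ z)) →
      (∀ z : F × F, ρ X (φ z) = 0) →
      ∀ x : b, (x : g) ∈ ({H, X} : Set g) → ∀ n, φ ⁅x, n⁆ = ρ x (φ n) := by
    rintro P _ _ ρ φ h₁ h₂ ⟨x, hx⟩ (rfl | rfl) n
    · rw [hHact]; exact h₁ n
    · rw [hXact, map_zero]; exact (h₂ n).symm
  have hjH : ∀ z : F × F, ⁅H, j z⁆ = j (lam * z.1 + z.2, lam * z.2) := fun z ↦ by
    rw [← hHact, hM.1]
  have hjX : ∀ z : F × F, ⁅X, j z⁆ = 0 := fun z ↦ by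
    rw [← map_zero j, ← hXact z, hM.1]
  have hjH₁ : ⁅H, j (1, 0)⁆ = lam • j (1, 0) := by
    rw [hjH, ← map_smul]; simp
  have hjH₂ : ⁅H, j (0, 1)⁆ = j (1, 0) + lam • j (0, 1) := by
    rw [hjH, ← map_smul, ← map_add]; simp
  obtain ⟨ρ, hρX, hρY, hρH⟩ :=
    exists_polynomial_rep hbasis hspan hHX hHY hXY (R := F) lam
  obtain ⟨r, hrv, hr, hur⟩ := hV.exists_coordinates hspan hHY hXY ρ hρX hρY hρH
  obtain ⟨f, hfv, -⟩ := hV.2 M (j (1, 0)) ⟨hjH₁, hjX _⟩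
  obtain ⟨p, hpj⟩ := hM.exists_hom hb (P := V) ((LinearMap.snd F F F).smulRight v)
    (hφb (fun a m ↦ ⁅a, m⁆) _ (fun z ↦ by simp [hV.1.1, smul_smul, mul_comm])
      (fun z ↦ by simp [hV.1.2]))
  have hp : ∀ z : F × F, p (j z) = z.2 • v := hpj
  have hpf : p.comp f = 0 := hV.hom_ext (by simp [hfv, hp])
  have hker : ∀ m, p m = 0 → m ∈ f.range := by
    let π := LieSubmodule.Quotient.mk' f.range
    have hπ₁ : π (j (1, 0)) = 0 :=
      (LieSubmodule.Quotient.mk_eq_zero _).2 ((f.mem_range _).2 ⟨v, hfv⟩)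
    obtain ⟨s, hs, -⟩ := hV.2 (M ⧸ f.range) (π (j (0, 1)))
      ⟨by rw [← LieModuleHom.map_lie, hjH₂, map_add, hπ₁, zero_add, map_smul],
        by rw [← LieModuleHom.map_lie, hjX, map_zero]⟩
    have hsp : s.comp p = π := hM.hom_ext fun z ↦ by
      have hz : z = z.1 • ((1, 0) : F × F) + z.2 • ((0, 1) : F × F) := by ext <;> simp
      rw [LieModuleHom.comp_apply, hp, map_smul, hs]
      conv_rhs => rw [hz, map_add, map_smul, map_smul, map_add, map_smul, map_smul, hπ₁]
      simp
    intro m hm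
    rw [← LieSubmodule.Quotient.mk_eq_zero]
    change π m = 0
    rw [← hsp, LieModuleHom.comp_apply, hm, map_zero]
  have hf : Function.Injective f := by
    obtain ⟨σ, hσX, hσY, hσH⟩ := exists_polynomial_rep hbasis hspan hHX hHY hXY
      (R := DualNumber F) (TrivSqZeroExt.inl lam + DualNumber.eps)
    let φ : F × F →ₗ[F] Polynomial (DualNumber F) :=
      (LinearMap.fst F F F).smulRight (Polynomial.C DualNumber.eps) +
        (LinearMap.snd F F F).smulRight 1
    have hφ : ∀ z : F × F, φ z = Polynomial.C (TrivSqZeroExt.inl z.2 + TrivSqZeroExt.inr z.1) := by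
      intro z
      change z.1 • Polynomial.C DualNumber.eps + z.2 • 1 = _
      rw [add_comm, Polynomial.smul_C, ← Polynomial.C_1, Polynomial.smul_C,
        ← Polynomial.C_add]
      congr 1
      ext <;> simp
    obtain ⟨q, hqj, hq⟩ := hM.exists_intertwiner hb σ φ (hφb (fun a m ↦ σ a m) φ
      (fun z ↦ by
        rw [hφ, hφ, hσH, Polynomial.derivative_C, mul_zero, mul_zero, sub_zero, ← Polynomial.C_mul]
        congr 1
        ext <;> simp)
      (fun z ↦ by simp [hφ, hσX]))
    rw [injective_iff_map_eq_zero]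
    intro m hm
    have key : (r m).map (algebraMap F (DualNumber F)) * Polynomial.C DualNumber.eps = 0 := by
      have h := congrArg q hm
      rw [← hur m, map_zero] at h
      change q ((f : V →ₗ[F] M) _) = 0 at h
      rw [map_aeval_end (f : V →ₗ[F] M) (T := LieModule.toEnd F g M Y) (fun m ↦ f.map_lie Y m),
        map_aeval_end q (T := LinearMap.mulLeft F Polynomial.X)
          (fun m ↦ (hq Y m).trans (hσY _)), aeval_mulLeft_X] at h
      change _ * q (f v) = 0 at h
      rwa [hfv, hqj, hφ, TrivSqZeroExt.inl_zero, zero_add] at h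
    have hrm : r m = 0 := by
      ext n
      have h := congrArg (fun P ↦ TrivSqZeroExt.snd (Polynomial.coeff P n)) key
      simpa [Polynomial.coeff_mul_C, Polynomial.coeff_map, TrivSqZeroExt.algebraMap_eq_inl] using h
    rw [← hur m, hrm]
    simp
  refine ⟨f, p, hf, ?_, ?_, ?_⟩
  · intro m
    refine ⟨Polynomial.aeval (LieModule.toEnd F g M Y) (r m) (j (0, 1)), ?_⟩
    change (p : M →ₗ[F] V) _ = m
    rw [map_aeval_end (p : M →ₗ[F] V) (T := LieModule.toEnd F g V Y) (fun m ↦ p.map_lie Y m)]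
    change Polynomial.aeval (LieModule.toEnd F g V Y) (r m) (p (j (0, 1))) = m
    rw [hp, one_smul, hur]
  · intro m
    refine ⟨fun hm ↦ (f.mem_range m).1 (hker m hm), ?_⟩
    rintro ⟨n, rfl⟩
    exact DFunLike.congr_fun hpf n
  · rintro ⟨s, hs⟩
    have hpsv : p (s v) = v := DFunLike.congr_fun hs v
    obtain ⟨m, hm⟩ := (f.mem_range _).1
      (hker (s v - j (0, 1)) (by rw [map_sub, hpsv, hp, one_smul, sub_self]))
    have hinj : v + ⁅H, m⁆ = lam • m := by
      apply hf
      have hsv : s v = j (0, 1) + f m := by rw [hm]; abel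
      have h : ⁅H, s v⁆ = lam • s v := by rw [← LieModuleHom.map_lie, hV.1.1, map_smul]
      rw [hsv, lie_add, hjH₂, smul_add, add_right_comm, add_comm _ (lam • _)] at h
      rw [map_add, LieModuleHom.map_lie, map_smul, hfv]
      exact add_left_cancel h
    have h := congrArg (fun m ↦ (r m).eval 0) hinj
    simp [hrv, hr, hρH, Polynomial.smul_eq_C_mul] at h

end PaperO
end
end
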